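/- There exist a number of agents n, a number of items m, an additive valuation profile, and an allocation x that is SD efficient but not SD⁺efficient. -/

import Mathlib

/-- Utility of a 0/1 bundle under additive valuation `v`. -/
noncomputable def utility {m : ℕ} (v : Fin m → ℝ) (a : Fin m → Bool) : ℝ :=
  ∑ j : Fin m, if a j then v j else 0

/-- `p` ranks the items in decreasing order of value, with ties broken toward the item
with the smaller index. -/
def IsRanking {m : ℕ} (v : Fin m → ℝ) (p : Fin m ≃ Fin m) : Prop :=
  ∀ k l : Fin m, k < l → v (p l) < v (p k) ∨ (v (p k) = v (p l) ∧ p k < p l)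

/-- The number `m_i` of items with strictly positive value. -/
noncomputable def numPos {m : ℕ} (v : Fin m → ℝ) : ℕ :=
  (Finset.univ.filter fun j => 0 < v j).card

/-- The number of items among the top `l+1` positions of the ranking `p` (1-based positions
`1, …, l+1`) that are present in the bundle `a`. -/
def prefixCount {m : ℕ} (p : Fin m ≃ Fin m) (a : Fin m → Bool) (l : Fin m) : ℕ :=
  ∑ k ∈ Finset.univ.filter fun k => k ≤ l, if a (p k) then 1 else 0

/-- `a ⪰⁺_i b`: the prefix-sum inequality holds at every position `ℓ ∈ {1, …, m_i}`. -/
noncomputable def SDPlusGE {m : ℕ} (v : Fin m → ℝ) (p : Fin m ≃ Fin m)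
    (a b : Fin m → Bool) : Prop :=
  ∀ l : Fin m, (l : ℕ) < numPos v → prefixCount p b l ≤ prefixCount p a l

/-- A (deterministic, complete) allocation: every item is assigned to exactly one agent. -/
def IsAlloc {n m : ℕ} (x : Fin n → Fin m → Bool) : Prop :=
  ∀ j : Fin m, ∃! i : Fin n, x i j = true

/-- Allocation `y` stochastically and positively dominates allocation `x`:
`y_i ⪰⁺_i x_i` for every agent `i`, and `y_j ≻⁺_j x_j` (i.e. `y_j ⪰⁺_j x_j` and
`y_j ≠ x_j`) for some agent `j`. -/
noncomputable def SDPlusDom {n m : ℕ} (v : Fin n → Fin m → ℝ)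
    (p : Fin n → (Fin m ≃ Fin m)) (y x : Fin n → Fin m → Bool) : Prop :=
  (∀ i, SDPlusGE (v i) (p i) (y i) (x i)) ∧
    ∃ i, SDPlusGE (v i) (p i) (y i) (x i) ∧ y i ≠ x i

/-- An allocation is SD⁺efficient iff no allocation stochastically and positively
dominates it. -/
noncomputable def SDPlusEfficient {n m : ℕ} (v : Fin n → Fin m → ℝ)
    (p : Fin n → (Fin m ≃ Fin m)) (x : Fin n → Fin m → Bool) : Prop :=
  ¬ ∃ y, IsAlloc y ∧ SDPlusDom v p y x

/-- An allocation is Pareto efficient iff no allocation weakly improves every agent's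
utility and strictly improves some agent's utility. -/
noncomputable def ParetoEfficient {n m : ℕ} (v : Fin n → Fin m → ℝ)
    (x : Fin n → Fin m → Bool) : Prop :=
  ¬ ∃ y, IsAlloc y ∧ (∀ i, utility (v i) (x i) ≤ utility (v i) (y i)) ∧
    ∃ i, utility (v i) (x i) < utility (v i) (y i)

/-- `a ⪰_i b`: the prefix-sum inequality holds at every position `ℓ ∈ {1, …, m}`. -/
def SDGE {m : ℕ} (p : Fin m ≃ Fin m) (a b : Fin m → Bool) : Prop :=
  ∀ l : Fin m, prefixCount p b l ≤ prefixCount p a l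

/-- Allocation `y` stochastically dominates allocation `x`: `y_i ⪰_i x_i` for every agent
`i`, and `y_j ≻_j x_j` (i.e. `y_j ⪰_j x_j` and `y_j ≠ x_j`) for some agent `j`. -/
def SDDom {n m : ℕ} (p : Fin n → (Fin m ≃ Fin m)) (y x : Fin n → Fin m → Bool) : Prop :=
  (∀ i, SDGE (p i) (y i) (x i)) ∧ ∃ i, SDGE (p i) (y i) (x i) ∧ y i ≠ x i

/-- An allocation is SD efficient iff no allocation stochastically dominates it. -/
def SDEfficient {n m : ℕ} (p : Fin n → (Fin m ≃ Fin m)) (x : Fin n → Fin m → Bool) : Prop :=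
  ¬ ∃ y, IsAlloc y ∧ SDDom p y x

/-- There exist agents, items, a nonnegative additive valuation profile, and an allocation
that is SD efficient but not SD⁺efficient. -/
theorem stmt5 :
    ∃ (n m : ℕ) (v : Fin n → Fin m → ℝ) (p : Fin n → (Fin m ≃ Fin m))
      (x : Fin n → Fin m → Bool),
      (∀ i j, 0 ≤ v i j) ∧ (∀ i, IsRanking (v i) (p i)) ∧ IsAlloc x ∧
        SDEfficient p x ∧ ¬ SDPlusEfficient v p x := by
  refine ⟨2, 1, fun i _ => if i = 0 then 0 else 1, fun _ => Equiv.refl _,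
    fun i _ => decide (i = 0), ?_, ?_, ?_, ?_, ?_⟩
  · intro i j
    dsimp only
    split_ifs <;> norm_num
  · intro i k l h
    exact absurd h (by simp [Subsingleton.elim k l])
  · intro j
    exact ⟨0, by simp, fun i hi => by simpa using hi⟩
  · rintro ⟨y, hy, hge, i, -, hne⟩
    have h0 : y 0 0 = true := by
      have h := hge 0 0
      by_contra hc
      simp [prefixCount, hc] at h
    apply hne
    funext j
    obtain rfl : j = 0 := Subsingleton.elim _ _
    by_cases hi : i = 0
    · simpa [hi] using h0
    · have hyi : y i 0 ≠ true := fun h => hi ((hy 0).unique h h0)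
      simpa [hi] using hyi
  · refine not_not_intro ⟨fun i _ => decide (i = 1), ?_, ?_⟩
    · intro j
      exact ⟨1, by simp, fun i hi => by simpa using hi⟩
    · have hge : ∀ i : Fin 2, SDPlusGE (fun _ : Fin 1 => if i = 0 then (0 : ℝ) else 1)
          (Equiv.refl _) (fun _ => decide (i = 1)) (fun _ => decide (i = 0)) := by
        intro i l hl
        fin_cases i
        · simp [numPos] at hl
        · simp [prefixCount]
      exact ⟨hge, 0, hge 0, fun h => by simpa using congrFun h 0⟩
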